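/- Suppose ∫_{ℝ^N} ‖𝒦(φ)‖² dμ₀(φ) < ∞. Then for every r > 0 there exists a constant M = M(r) > 0 such that for all Y, Y' ∈ H with ‖Y‖ ≤ r and ‖Y'‖ ≤ r, one has ∫_{ℝ^N} ( exp(−G(φ; Y)/2) − exp(−G(φ; Y')/2) )² dμ₀(φ) ≤ M ‖Y − Y'‖². -/

import Mathlib

open Real MeasureTheory

/-- On the nonnegative reals, `t ↦ exp (-t)` is a contraction. -/
lemma abs_exp_neg_sub_exp_neg_le {a b : ℝ} (ha : 0 ≤ a) (hb : 0 ≤ b) :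
    |Real.exp (-a) - Real.exp (-b)| ≤ |a - b| := by
  wlog hab : a ≤ b generalizing a b
  · rw [abs_sub_comm, abs_sub_comm a]
    exact this hb ha (le_of_not_ge hab)
  have hmono : Real.exp (-b) ≤ Real.exp (-a) := Real.exp_le_exp.2 (neg_le_neg hab)
  rw [abs_of_nonneg (sub_nonneg.2 hmono), abs_sub_comm, abs_of_nonneg (sub_nonneg.2 hab)]
  have hle : Real.exp (-a) ≤ 1 := Real.exp_le_one_iff.2 (neg_nonpos.2 ha)
  have hmul : Real.exp (-b) = Real.exp (-a) * Real.exp (a - b) := by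
    rw [← Real.exp_add]
    congr 1
    ring
  have hlin := Real.add_one_le_exp (a - b)
  nlinarith [Real.exp_pos (-a)]

/-- Local Lipschitz estimate for the squared distance to a fixed point. -/
lemma abs_norm_sub_sq_sub_norm_sub_sq_le {E : Type*} [SeminormedAddCommGroup E] {y y' : E}
    {r : ℝ} (hy : ‖y‖ ≤ r) (hy' : ‖y'‖ ≤ r) (x : E) :
    |‖y - x‖ ^ 2 - ‖y' - x‖ ^ 2| ≤ 2 * (r + ‖x‖) * ‖y - y'‖ := by
  have hdiff : |‖y - x‖ - ‖y' - x‖| ≤ ‖y - y'‖ := by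
    simpa using abs_norm_sub_norm_le (y - x) (y' - x)
  have hsum : ‖y - x‖ + ‖y' - x‖ ≤ 2 * (r + ‖x‖) := by
    linarith [norm_sub_le y x, norm_sub_le y' x]
  rw [sq_sub_sq, abs_mul, abs_of_nonneg (by positivity : 0 ≤ ‖y - x‖ + ‖y' - x‖)]
  exact mul_le_mul hsum hdiff (abs_nonneg _) (le_trans (by positivity) hsum)

/-- Pointwise quadratic stability of the square root of a Gaussian likelihood. -/
lemma sq_sqrt_likelihood_sub_le {E : Type*} [SeminormedAddCommGroup E] {y y' : E} {γ r : ℝ}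
    (hγ : 0 < γ) (hy : ‖y‖ ≤ r) (hy' : ‖y'‖ ≤ r) (x : E) :
    (Real.exp (-(‖y - x‖ ^ 2 / (2 * γ ^ 2)) / 2)
        - Real.exp (-(‖y' - x‖ ^ 2 / (2 * γ ^ 2)) / 2)) ^ 2
      ≤ (r ^ 2 + ‖x‖ ^ 2) * (‖y - y'‖ ^ 2 / (2 * γ ^ 4)) := by
  have hexp := abs_exp_neg_sub_exp_neg_le
    (by positivity : 0 ≤ ‖y - x‖ ^ 2 / (2 * γ ^ 2) / 2)
    (by positivity : 0 ≤ ‖y' - x‖ ^ 2 / (2 * γ ^ 2) / 2)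
  rw [neg_div, neg_div]
  refine (sq_le_sq.2 hexp).trans ?_
  have hsq := pow_le_pow_left₀ (abs_nonneg _) (abs_norm_sub_sq_sub_norm_sub_sq_le hy hy' x) 2
  rw [sq_abs] at hsq
  calc (‖y - x‖ ^ 2 / (2 * γ ^ 2) / 2 - ‖y' - x‖ ^ 2 / (2 * γ ^ 2) / 2) ^ 2
      = (‖y - x‖ ^ 2 - ‖y' - x‖ ^ 2) ^ 2 / (16 * γ ^ 4) := by
        field_simp
        ring
    _ ≤ (2 * (r + ‖x‖) * ‖y - y'‖) ^ 2 / (16 * γ ^ 4) := by gcongr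
    _ = (r + ‖x‖) ^ 2 / 2 * (‖y - y'‖ ^ 2 / (2 * γ ^ 4)) := by
        field_simp
        ring
    _ ≤ (r ^ 2 + ‖x‖ ^ 2) * (‖y - y'‖ ^ 2 / (2 * γ ^ 4)) := by
        gcongr
        nlinarith [sq_nonneg (r - ‖x‖)]

/-- Quadratic stability of the square-root likelihood: if `∫ ‖𝒦(φ)‖² dμ₀(φ) < ∞`,
then for every `r > 0` there is `M > 0` such that for all `‖Y‖ ≤ r`, `‖Y'‖ ≤ r`,
`∫ (exp(−G(φ;Y)/2) − exp(−G(φ;Y')/2))² dμ₀(φ) ≤ M ‖Y − Y'‖²`,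
where `G(φ; Y) = ‖Y − 𝒦(φ)‖²/(2γ²)`. -/
theorem sqrt_likelihood_stability
    {𝕜 : Type*} [RCLike 𝕜] {H : Type*} [NormedAddCommGroup H] [InnerProductSpace 𝕜 H]
    [CompleteSpace H] [MeasurableSpace H] [BorelSpace H] {N : ℕ} (γ : ℝ) (hγ : 0 < γ)
    (μ₀ : Measure (EuclideanSpace ℝ (Fin N))) [IsProbabilityMeasure μ₀]
    (𝒦 : EuclideanSpace ℝ (Fin N) → H) (hK : Measurable 𝒦)
    (hint : Integrable (fun φ => ‖𝒦 φ‖ ^ 2) μ₀) (r : ℝ) (hr : 0 < r) :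
    ∃ M : ℝ, 0 < M ∧ ∀ Y Y' : H, ‖Y‖ ≤ r → ‖Y'‖ ≤ r →
      (∫ φ, (Real.exp (-(‖Y - 𝒦 φ‖ ^ 2 / (2 * γ ^ 2)) / 2)
          - Real.exp (-(‖Y' - 𝒦 φ‖ ^ 2 / (2 * γ ^ 2)) / 2)) ^ 2 ∂μ₀)
        ≤ M * ‖Y - Y'‖ ^ 2 := by
  have hI : 0 ≤ ∫ φ, ‖𝒦 φ‖ ^ 2 ∂μ₀ := integral_nonneg fun φ => by positivity
  refine ⟨(r ^ 2 + ∫ φ, ‖𝒦 φ‖ ^ 2 ∂μ₀) / (2 * γ ^ 4), by positivity, fun Y Y' hY hY' => ?_⟩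
  calc _ ≤ ∫ φ, (r ^ 2 + ‖𝒦 φ‖ ^ 2) * (‖Y - Y'‖ ^ 2 / (2 * γ ^ 4)) ∂μ₀ :=
        integral_mono_of_nonneg (.of_forall fun φ => sq_nonneg _)
          (((integrable_const _).add hint).mul_const _)
          (.of_forall fun φ => sq_sqrt_likelihood_sub_le hγ hY hY' (𝒦 φ))
    _ = _ := by
        rw [integral_mul_const, integral_add (integrable_const _) hint]
        simp only [integral_const, probReal_univ, one_smul]
        ring
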